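/- Let J : ℚ_p^n → [0,∞) satisfy Hypothesis A. Let u_0 : ℚ_p^n → ℂ be a radial locally constant compactly supported function whose Fourier transform is supported in the ball B_M^n = {‖ξ‖_p ≤ p^M} for some M ∈ ℤ, and write û(r) for the common value of Fu_0 on the sphere {‖ξ‖_p = r} and Ĵ(r) for the common value of FJ on {‖ξ‖_p = r}. Then for every t ≥ 0 and x ≠ 0, the function u(x,t) = ∫_{ℚ_p^n} χ_p(−ξ·x) e^{−t(1−(FJ)(ξ))} (Fu_0)(ξ) d^n ξ equals −𝟙{‖x‖_p > p^{−M}} · ‖x‖_p^{−n} e^{−t(1−Ĵ(p‖x‖_p^{−1}))} û(p‖x‖_p^{−1}) + (1−p^{−n}) Σ_{j=K}^∞ p^{−nj} e^{−t(1−Ĵ(p^{−j}))} û(p^{−j}), where K = −M if ‖x‖_p ≤ p^{−M}, K = −M+1 if ‖x‖_p = p^{−M+1}, and K = −ord_p(x) if ‖x‖_p ≥ p^{−M+2} (here ‖x‖_p = p^{−ord_p(x)}). -/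

import Mathlib

open MeasureTheory Filter

noncomputable section

namespace PadicPaper

attribute [local instance] Classical.propDecidable

variable (p : ℕ) [Fact p.Prime]

instance : MeasurableSpace ℚ_[p] := borel _
instance : BorelSpace ℚ_[p] := ⟨rfl⟩

variable (n : ℕ)

/-- `ℚ_p^n` with the sup norm `‖x‖ = max |x i|_p`. -/
abbrev V := Fin n → ℚ_[p]

/-- The `p`-adic fractional part of `y`: the unique rational `r ∈ [0,1)` whose denominator is a
power of `p` such that `y - r ∈ ℤ_p`. -/
def frac (y : ℚ_[p]) : ℚ :=
  if h : ∃ r : ℚ, 0 ≤ r ∧ r < 1 ∧ (∃ m : ℕ, (r * (p : ℚ) ^ m).den = 1) ∧ ‖y - (r : ℚ_[p])‖ ≤ 1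
  then h.choose else 0

/-- The standard additive character `χ_p(y) = exp(2 π i {y}_p)` of `ℚ_p`. -/
def stdChar (y : ℚ_[p]) : ℂ := Complex.exp (2 * Real.pi * Complex.I * (frac p y : ℂ))

/-- `ξ·x = Σ ξ_i x_i`. -/
def dotP (ξ x : V p n) : ℚ_[p] := ∑ i, ξ i * x i

/-- Fourier transform with respect to the (normalized Haar) measure `μ`:
`(Ff)(ξ) = ∫ χ_p(ξ·x) f(x) dμ(x)`. -/
def FT (μ : Measure (V p n)) (f : V p n → ℂ) (ξ : V p n) : ℂ :=
  ∫ x, stdChar p (dotP p n ξ x) * f x ∂μ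

/-- `ℤ_p^n` as a subset of `ℚ_p^n`. -/
def Zpn : Set (V p n) := {x | ‖x‖ ≤ 1}

/-- Hypothesis A: `J` is a nonnegative radial a.e.-continuous function with total integral 1. -/
structure HypA (μ : Measure (V p n)) (J : V p n → ℝ) : Prop where
  nonneg : ∀ x, 0 ≤ J x
  radial : ∀ x y : V p n, ‖x‖ = ‖y‖ → J x = J y
  aecont : ∀ᵐ x ∂μ, ContinuousAt J x
  integrable : Integrable J μ
  int_one : ∫ x, J x ∂μ = 1

/-- The Fourier transform of (the complexification of) `J`. -/
def FJ (μ : Measure (V p n)) (J : V p n → ℝ) (ξ : V p n) : ℂ :=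
  FT p n μ (fun x => (J x : ℂ)) ξ

/-- A representative point of `ℚ_p^n` of norm `r` (junk value `0` if no such point exists);
used to evaluate radial functions at a given radius. -/
def repVec (r : ℝ) : V p n :=
  if h : ∃ v : V p n, ‖v‖ = r then h.choose else 0

/-- The heat kernel
`Z_t(x) = ‖x‖^{-n} (1-p^{-n}) Σ_{j≥0} p^{-nj} (e^{-t(1-(FJ)(p^{-j}‖x‖⁻¹))} - e^{-t(1-(FJ)(p‖x‖⁻¹))})`. -/
def heatZ (μ : Measure (V p n)) (J : V p n → ℝ) (t : ℝ) (x : V p n) : ℝ :=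
  ‖x‖ ^ (-(n : ℤ)) * (1 - (p : ℝ) ^ (-(n : ℤ))) * ∑' j : ℕ,
    (p : ℝ) ^ (-((n * j : ℕ) : ℤ)) *
      (Real.exp (-(t * (1 - (FJ p n μ J (repVec p n ((p : ℝ) ^ (-(j : ℤ)) * ‖x‖⁻¹))).re))) -
       Real.exp (-(t * (1 - (FJ p n μ J (repVec p n ((p : ℝ) * ‖x‖⁻¹))).re))))

/-- `J` is of linear type: Hypothesis A together with `B‖x‖^{-(α+1)} ≤ J(x) ≤ C‖x‖^{-(α+1)}`. -/
structure LinearType (μ : Measure (V p n)) (J : V p n → ℝ) (B C α : ℝ) : Prop where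
  hypA : HypA p n μ J
  hB : 0 < B
  hBC : B ≤ C
  hα : 0 < α
  lower : ∀ x : V p n, x ≠ 0 → B / ‖x‖ ^ (α + 1) ≤ J x
  upper : ∀ x : V p n, x ≠ 0 → J x ≤ C / ‖x‖ ^ (α + 1)

/-- `J` is of logarithmic type: Hypothesis A together with
`D ln^α(1+‖x‖)‖x‖^{-β} ≤ J(x) ≤ E ln^α(1+‖x‖)‖x‖^{-β}`. -/
structure LogType (μ : Measure (V p n)) (J : V p n → ℝ) (D E α β : ℝ) : Prop where
  hypA : HypA p n μ J
  hD : 0 < D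
  hDE : D ≤ E
  hα : 0 < α
  hβ : 0 < β
  lower : ∀ x : V p n, x ≠ 0 → D * Real.log (1 + ‖x‖) ^ α / ‖x‖ ^ β ≤ J x
  upper : ∀ x : V p n, x ≠ 0 → J x ≤ E * Real.log (1 + ‖x‖) ^ α / ‖x‖ ^ β

/-- The lower incomplete gamma function `γ(s,x) = ∫_0^x z^{s-1} e^{-z} dz`. -/
def lgamma (s x : ℝ) : ℝ := ∫ z in (0:ℝ)..x, z ^ (s - 1) * Real.exp (-z)


lemma frac_exists (y : ℚ_[p]) : ∃ r : ℚ, 0 ≤ r ∧ r < 1 ∧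
    (∃ m : ℕ, (r * (p : ℚ) ^ m).den = 1) ∧ ‖y - (r : ℚ_[p])‖ ≤ 1 := by
  have hp : (1 : ℝ) < p := by exact_mod_cast (Fact.out : p.Prime).one_lt
  have hp0 : (p : ℚ) ≠ 0 := by exact_mod_cast (Fact.out : p.Prime).ne_zero
  have hp0' : (p : ℚ_[p]) ≠ 0 := by exact_mod_cast (Fact.out : p.Prime).ne_zero
  obtain ⟨m, hm⟩ := pow_unbounded_of_one_lt ‖y‖ hp
  have h1 : ‖(p : ℚ_[p]) ^ m * y‖ ≤ 1 := by
    rw [norm_mul, norm_pow, Padic.norm_p, inv_pow, inv_mul_le_iff₀ (by positivity)]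
    linarith
  set z : ℤ_[p] := ⟨(p : ℚ_[p]) ^ m * y, h1⟩ with hz
  have h2 := PadicInt.appr_spec m z
  rw [← PadicInt.norm_le_pow_iff_mem_span_pow] at h2
  have h3 := PadicInt.appr_lt z m
  refine ⟨(z.appr m : ℚ) / (p : ℚ) ^ m, by positivity, ?_, ⟨m, ?_⟩, ?_⟩
  · rw [div_lt_one (by have := (Fact.out : p.Prime).pos; positivity)]
    exact_mod_cast h3
  · rw [div_mul_cancel₀ _ (pow_ne_zero _ hp0)]
    simp
  · have h4 : y - (((z.appr m : ℚ) / (p : ℚ) ^ m : ℚ) : ℚ_[p]) =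
        ((p : ℚ_[p]) ^ m)⁻¹ * ((z - (z.appr m : ℤ_[p]) : ℤ_[p]) : ℚ_[p]) := by
      rw [PadicInt.coe_sub, hz]
      push_cast
      field_simp
    rw [h4, norm_mul, norm_inv, norm_pow, Padic.norm_p, inv_pow, inv_inv, ← PadicInt.norm_def]
    rw [zpow_neg, zpow_natCast] at h2
    calc (p : ℝ) ^ m * ‖z - (z.appr m : ℤ_[p])‖ ≤ (p : ℝ) ^ m * ((p : ℝ) ^ m)⁻¹ := by gcongr
      _ = 1 := mul_inv_cancel₀ (by positivity)

lemma frac_spec (y : ℚ_[p]) : 0 ≤ frac p y ∧ frac p y < 1 ∧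
    (∃ m : ℕ, (frac p y * (p : ℚ) ^ m).den = 1) ∧ ‖y - (frac p y : ℚ_[p])‖ ≤ 1 := by
  have h := frac_exists p y
  unfold frac
  rw [dif_pos h]
  exact h.choose_spec

lemma int_of_pp (r : ℚ) (m : ℕ) (z : ℤ) (h : r * (p : ℚ) ^ m = z) (hr : ‖(r : ℚ_[p])‖ ≤ 1) :
    ∃ w : ℤ, r = w := by
  have hp0 : (p : ℚ) ≠ 0 := by exact_mod_cast (Fact.out : p.Prime).ne_zero
  have h1 : ‖(z : ℚ_[p])‖ ≤ (p : ℝ) ^ (-(m : ℤ)) := by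
    have : (z : ℚ_[p]) = (r : ℚ_[p]) * (p : ℚ_[p]) ^ m := by
      have := congrArg (fun q : ℚ => (q : ℚ_[p])) h
      push_cast at this
      exact this.symm
    rw [this, norm_mul, norm_pow, Padic.norm_p, zpow_neg, zpow_natCast, inv_pow]
    exact mul_le_of_le_one_left (by positivity) hr
  rw [Padic.norm_int_le_pow_iff_dvd] at h1
  obtain ⟨w, hw⟩ := h1
  refine ⟨w, ?_⟩
  apply mul_right_cancel₀ (pow_ne_zero m hp0)
  rw [h, hw]
  push_cast
  ring

lemma frac_pp (y : ℚ_[p]) : ∃ m : ℕ, ∃ z : ℤ, frac p y * (p : ℚ) ^ m = z := by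
  obtain ⟨m, hm⟩ := (frac_spec p y).2.2.1
  exact ⟨m, _, (Rat.den_eq_one_iff _).1 hm |>.symm⟩

lemma norm_three {a b c : ℚ_[p]} (ha : ‖a‖ ≤ 1) (hb : ‖b‖ ≤ 1) (hc : ‖c‖ ≤ 1) :
    ‖a + b + c‖ ≤ 1 :=
  (Padic.nonarchimedean _ _).trans
    (max_le ((Padic.nonarchimedean _ _).trans (max_le ha hb)) hc)

lemma frac_add (a b : ℚ_[p]) : ∃ w : ℤ, frac p (a + b) - frac p a - frac p b = w := by
  obtain ⟨m1, z1, h1⟩ := frac_pp p (a + b)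
  obtain ⟨m2, z2, h2⟩ := frac_pp p a
  obtain ⟨m3, z3, h3⟩ := frac_pp p b
  refine int_of_pp p _ (m1 + m2 + m3)
    (z1 * p ^ (m2 + m3) - z2 * p ^ (m1 + m3) - z3 * p ^ (m1 + m2)) ?_ ?_
  · push_cast
    rw [← h1, ← h2, ← h3]
    ring
  · have e : ((frac p (a + b) - frac p a - frac p b : ℚ) : ℚ_[p]) =
      -((a + b) - (frac p (a + b) : ℚ_[p])) + (a - (frac p a : ℚ_[p])) +
        (b - (frac p b : ℚ_[p])) := by
      push_cast; ring
    rw [e]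
    exact norm_three p (by rw [norm_neg]; exact (frac_spec p _).2.2.2)
      (frac_spec p _).2.2.2 (frac_spec p _).2.2.2

lemma stdChar_add (a b : ℚ_[p]) : stdChar p (a + b) = stdChar p a * stdChar p b := by
  obtain ⟨w, hw⟩ := frac_add p a b
  unfold stdChar
  rw [← Complex.exp_add, Complex.exp_eq_exp_iff_exists_int]
  refine ⟨w, ?_⟩
  have : (frac p (a + b) : ℂ) = frac p a + frac p b + w := by
    have := congrArg (fun q : ℚ => (q : ℂ)) hw
    push_cast at this
    linear_combination this
  rw [this]; ring

lemma norm_stdChar (a : ℚ_[p]) : ‖stdChar p a‖ = 1 := by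
  unfold stdChar
  have : (2 * Real.pi * Complex.I * (frac p a : ℂ)) =
    ((2 * Real.pi * (frac p a : ℝ) : ℝ) : ℂ) * Complex.I := by push_cast; ring
  rw [this, Complex.norm_exp_ofReal_mul_I]

lemma stdChar_of_le {a : ℚ_[p]} (h : ‖a‖ ≤ 1) : stdChar p a = 1 := by
  obtain ⟨h0, h1, -, h2⟩ := frac_spec p a
  obtain ⟨m, z, hz⟩ := frac_pp p a
  obtain ⟨w, hw⟩ := int_of_pp p _ m z hz (by
    have : (frac p a : ℚ_[p]) = -(a - (frac p a : ℚ_[p])) + a + 0 := by ring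
    rw [this]
    exact norm_three p (by rwa [norm_neg]) h (by simp))
  have : w = 0 := by
    rw [hw] at h0 h1
    have h0' : 0 ≤ w := by exact_mod_cast h0
    have h1' : w < 1 := by exact_mod_cast h1
    omega
  unfold stdChar
  rw [hw, this]; simp

lemma stdChar_ne {a : ℚ_[p]} (h : 1 < ‖a‖) : stdChar p a ≠ 1 := by
  intro h'
  obtain ⟨h0, h1, -, h2⟩ := frac_spec p a
  unfold stdChar at h'
  rw [Complex.exp_eq_one_iff] at h'
  obtain ⟨k, hk⟩ := h'
  have hk' : (frac p a : ℂ) = k := by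
    have hpi : (2 * Real.pi * Complex.I : ℂ) ≠ 0 := Complex.two_pi_I_ne_zero
    apply mul_left_cancel₀ hpi
    rw [hk]; ring
  have hk2 : frac p a = k := by exact_mod_cast hk'
  rw [hk2] at h0 h1
  have h0' : 0 ≤ k := by exact_mod_cast h0
  have h1' : k < 1 := by exact_mod_cast h1
  have : k = 0 := by omega
  rw [hk2, this] at h2
  simp at h2
  linarith

lemma continuous_stdChar : Continuous (stdChar p) := by
  apply IsLocallyConstant.continuous
  rw [IsLocallyConstant.iff_eventually_eq]
  intro x
  filter_upwards [Metric.ball_mem_nhds x one_pos] with y hy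
  have : y = x + (y - x) := by ring
  rw [this, stdChar_add, stdChar_of_le p (a := y - x), mul_one]
  rw [Metric.mem_ball, dist_eq_norm] at hy
  exact hy.le

lemma dotP_add (a b x : V p n) : dotP p n (a + b) x = dotP p n a x + dotP p n b x := by
  simp [dotP, add_mul, Finset.sum_add_distrib]

lemma dotP_neg (a x : V p n) : dotP p n a (-x) = - dotP p n a x := by
  simp [dotP]

lemma dotP_comm (a x : V p n) : dotP p n a x = dotP p n x a := by
  simp [dotP, mul_comm]

lemma continuous_dotP (x : V p n) : Continuous (fun ξ => dotP p n ξ x) := by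
  unfold dotP; fun_prop

lemma norm_dotP_le (a x : V p n) : ‖dotP p n a x‖ ≤ ‖a‖ * ‖x‖ := by
  unfold dotP
  apply IsUltrametricDist.norm_sum_le_of_forall_le_of_nonneg (by positivity)
  intro i _
  rw [norm_mul]
  exact mul_le_mul (norm_le_pi_norm a i) (norm_le_pi_norm x i) (by positivity) (by positivity)

lemma exists_zpow_norm {x : V p n} (hx : x ≠ 0) : ∃ i : Fin n, ∃ k : ℤ,
    ‖x i‖ = ‖x‖ ∧ ‖x‖ = (p : ℝ) ^ k := by
  have hne : Nonempty (Fin n) := by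
    by_contra h
    rw [not_nonempty_iff] at h
    exact hx (Subsingleton.elim _ _)
  obtain ⟨i, hi⟩ := Finite.exists_max (fun i => ‖x i‖)
  have h1 : ‖x i‖ = ‖x‖ := le_antisymm (norm_le_pi_norm x i)
    ((pi_norm_le_iff_of_nonneg (norm_nonneg _)).2 hi)
  have h2 : x i ≠ 0 := by
    rw [← norm_ne_zero_iff, h1]; simpa using hx
  exact ⟨i, _, h1, h1 ▸ Padic.norm_eq_zpow_neg_valuation h2⟩

lemma norm_p_zpow (k : ℤ) : ‖(p : ℚ_[p]) ^ (-k)‖ = (p : ℝ) ^ k := by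
  simp

lemma norm_repVec (hn : 0 < n) (k : ℤ) : ‖repVec p n ((p : ℝ) ^ k)‖ = (p : ℝ) ^ k := by
  have h : ∃ v : V p n, ‖v‖ = (p : ℝ) ^ k := by
    refine ⟨Pi.single ⟨0, hn⟩ ((p : ℚ_[p]) ^ (-k)), ?_⟩
    rw [Pi.norm_single, norm_p_zpow]
  unfold repVec
  rw [dif_pos h]
  exact h.choose_spec

/-- The ball of radius `p ^ k`. -/
def bal (k : ℤ) : Set (V p n) := {ξ | ‖ξ‖ ≤ (p : ℝ) ^ k}

/-- The sphere of radius `p ^ k`. -/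
def sph (k : ℤ) : Set (V p n) := {ξ | ‖ξ‖ = (p : ℝ) ^ k}

lemma one_lt_p : (1 : ℝ) < p := by exact_mod_cast (Fact.out : p.Prime).one_lt

lemma isClosed_bal (k : ℤ) : IsClosed (bal p n k) := isClosed_le continuous_norm continuous_const

lemma isClosed_sph (k : ℤ) : IsClosed (sph p n k) := isClosed_eq continuous_norm continuous_const

lemma bal_eq (k : ℤ) : bal p n k = Metric.closedBall 0 ((p : ℝ) ^ k) := by
  ext x; simp [bal]

lemma digit_exists (k : ℤ) (x : ℚ_[p]) (hx : ‖x‖ ≤ (p : ℝ) ^ (k + 1)) :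
    ∃ a : Fin p, ‖x - (p : ℚ_[p]) ^ (-(k + 1)) * ((a : ℕ) : ℚ_[p])‖ ≤ (p : ℝ) ^ k := by
  have hp0' : (p : ℚ_[p]) ≠ 0 := by exact_mod_cast (Fact.out : p.Prime).ne_zero
  have hp := one_lt_p p
  have h1 : ‖(p : ℚ_[p]) ^ (k + 1) * x‖ ≤ 1 := by
    have h := norm_p_zpow p (-(k + 1))
    rw [neg_neg] at h
    rw [norm_mul, h]
    calc _ ≤ (p : ℝ) ^ (-(k + 1)) * (p : ℝ) ^ (k + 1) := by gcongr
      _ = 1 := by rw [← zpow_add₀ (by positivity)]; simp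
  obtain ⟨m, hm, hm2⟩ := PadicInt.exists_mem_range (⟨_, h1⟩ : ℤ_[p])
  refine ⟨⟨m, hm⟩, ?_⟩
  rw [IsLocalRing.mem_maximalIdeal, PadicInt.mem_nonunits, PadicInt.norm_def] at hm2
  have e : x - (p : ℚ_[p]) ^ (-(k + 1)) * ((m : ℕ) : ℚ_[p]) =
      (p : ℚ_[p]) ^ (-(k + 1)) * ((p : ℚ_[p]) ^ (k + 1) * x - (m : ℚ_[p])) := by
    rw [mul_sub, ← mul_assoc, ← zpow_add₀ hp0']; simp
  simp only
  rw [Padic.norm_le_pow_iff_norm_lt_pow_add_one, e, norm_mul, norm_p_zpow]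
  exact mul_lt_of_lt_one_right (by positivity) hm2

lemma digit_unique (k : ℤ) (x : ℚ_[p]) (a b : Fin p)
    (ha : ‖x - (p : ℚ_[p]) ^ (-(k + 1)) * ((a : ℕ) : ℚ_[p])‖ ≤ (p : ℝ) ^ k)
    (hb : ‖x - (p : ℚ_[p]) ^ (-(k + 1)) * ((b : ℕ) : ℚ_[p])‖ ≤ (p : ℝ) ^ k) : a = b := by
  have hp := one_lt_p p
  have h : ‖(p : ℚ_[p]) ^ (-(k + 1)) * (((a : ℕ) : ℤ) - ((b : ℕ) : ℤ) : ℤ)‖ ≤ (p : ℝ) ^ k := by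
    have e : (p : ℚ_[p]) ^ (-(k + 1)) * ((((a : ℕ) : ℤ) - ((b : ℕ) : ℤ) : ℤ) : ℚ_[p]) =
      (x - (p : ℚ_[p]) ^ (-(k + 1)) * ((b : ℕ) : ℚ_[p])) +
      -(x - (p : ℚ_[p]) ^ (-(k + 1)) * ((a : ℕ) : ℚ_[p])) := by push_cast; ring
    rw [e]
    exact (Padic.nonarchimedean _ _).trans (max_le hb (by rwa [norm_neg]))
  rw [norm_mul, norm_p_zpow, zpow_add_one₀ (by positivity)] at h
  have h2 : ‖((((a : ℕ) : ℤ) - ((b : ℕ) : ℤ) : ℤ) : ℚ_[p])‖ < 1 := by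
    by_contra h3
    push Not at h3
    have : (p : ℝ) ^ k * p * 1 ≤ (p : ℝ) ^ k := le_trans (by gcongr) h
    have h4 : (0 : ℝ) < (p : ℝ) ^ k := by positivity
    nlinarith
  rw [← PadicInt.norm_intCast_eq_padic_norm, PadicInt.norm_int_lt_one_iff_dvd] at h2
  have h5 := Int.eq_zero_of_abs_lt_dvd h2 (by
    have := a.2; have := b.2
    rw [abs_lt]; omega)
  apply Fin.ext
  omega

lemma measure_bal_succ (μ : Measure (V p n)) [μ.IsAddHaarMeasure] (k : ℤ) :
    μ (bal p n (k + 1)) = (p : ENNReal) ^ n * μ (bal p n k) := by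
  set v : (Fin n → Fin p) → V p n :=
    fun a i => (p : ℚ_[p]) ^ (-(k + 1)) * ((a i : ℕ) : ℚ_[p]) with hv
  have hp := one_lt_p p
  have hk : (p : ℝ) ^ k ≤ (p : ℝ) ^ (k + 1) := zpow_le_zpow_right₀ hp.le (by omega)
  have hU : bal p n (k + 1) = ⋃ a, (fun x => -(v a) + x) ⁻¹' (bal p n k) := by
    ext x
    simp only [Set.mem_iUnion, Set.mem_preimage, bal, Set.mem_ofPred_eq]
    constructor
    · intro hx
      choose a ha using fun i => digit_exists p k (x i) ((norm_le_pi_norm x i).trans hx)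
      refine ⟨a, ?_⟩
      rw [pi_norm_le_iff_of_nonneg (by positivity)]
      intro i
      have := ha i
      rw [Pi.add_apply, Pi.neg_apply, neg_add_eq_sub]
      exact this
    · rintro ⟨a, ha⟩
      rw [pi_norm_le_iff_of_nonneg (by positivity)] at ha ⊢
      intro i
      have e : x i = (-(v a) + x) i + v a i := by simp
      rw [e]
      refine (Padic.nonarchimedean _ _).trans (max_le ((ha i).trans hk) ?_)
      simp only [hv]
      rw [norm_mul, norm_p_zpow]
      exact mul_le_of_le_one_right (by positivity) (by
        exact_mod_cast Padic.norm_int_le_one (p := p) ((a i : ℕ) : ℤ))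
  rw [hU, measure_iUnion]
  · simp_rw [measure_preimage_add]
    rw [tsum_fintype, Finset.sum_const]
    simp
  · intro a b hab
    rw [Function.onFun, Set.disjoint_left]
    intro x hxa hxb
    apply hab
    ext1 i
    simp only [Set.mem_preimage, bal, Set.mem_ofPred_eq] at hxa hxb
    apply digit_unique p k (x i)
    · have := (norm_le_pi_norm _ i).trans hxa
      rwa [Pi.add_apply, Pi.neg_apply, neg_add_eq_sub] at this
    · have := (norm_le_pi_norm _ i).trans hxb
      rwa [Pi.add_apply, Pi.neg_apply, neg_add_eq_sub] at this
  · intro a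
    exact ((isClosed_bal p n k).preimage (by fun_prop)).measurableSet

lemma measureReal_bal (μ : Measure (V p n)) [μ.IsAddHaarMeasure] (hμ : μ (Zpn p n) = 1) (k : ℤ) :
    μ.real (bal p n k) = (p : ℝ) ^ ((n : ℤ) * k) := by
  have hp := one_lt_p p
  have hs : ∀ k, μ.real (bal p n (k + 1)) = (p : ℝ) ^ n * μ.real (bal p n k) := by
    intro k
    rw [Measure.real, measure_bal_succ]
    simp [Measure.real]
  induction k using Int.induction_on with
  | zero =>
    have : bal p n 0 = Zpn p n := by simp [bal, Zpn]
    rw [Measure.real, this, hμ]; simp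
  | succ i ih =>
    rw [hs, ih, ← zpow_natCast, ← zpow_add₀ (by positivity)]; congr 1; ring
  | pred i ih =>
    have h := hs (-(i : ℤ) - 1)
    rw [sub_add_cancel, ih] at h
    have h2 : (p : ℝ) ^ ((n : ℤ) * (-(i : ℤ))) =
        (p : ℝ) ^ n * (p : ℝ) ^ ((n : ℤ) * (-(i : ℤ) - 1)) := by
      rw [← zpow_natCast, ← zpow_add₀ (by positivity)]; congr 1; ring
    rw [h2] at h
    exact (mul_left_cancel₀ (by positivity) h).symm

lemma measure_bal_lt_top (μ : Measure (V p n)) [μ.IsAddHaarMeasure] (k : ℤ) :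
    μ (bal p n k) < ⊤ := by
  rw [bal_eq]; exact (isCompact_closedBall _ _).measure_lt_top

lemma continuous_char (x : V p n) : Continuous (fun ξ => stdChar p (dotP p n ξ x)) :=
  (continuous_stdChar p).comp (continuous_dotP p n x)

lemma integral_bal_le (μ : Measure (V p n)) [μ.IsAddHaarMeasure] (hμ : μ (Zpn p n) = 1)
    (x : V p n) (L k : ℤ) (hx : ‖x‖ = (p : ℝ) ^ (-L)) (hk : k ≤ L) :
    ∫ ξ in bal p n k, stdChar p (dotP p n ξ x) ∂μ = (((p : ℝ) ^ ((n : ℤ) * k) : ℝ) : ℂ) := by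
  have hp := one_lt_p p
  have : ∫ ξ in bal p n k, stdChar p (dotP p n ξ x) ∂μ = ∫ ξ in bal p n k, (1 : ℂ) ∂μ := by
    apply setIntegral_congr_fun (isClosed_bal p n k).measurableSet
    intro ξ hξ
    apply stdChar_of_le
    refine (norm_dotP_le p n ξ x).trans ?_
    calc _ ≤ (p : ℝ) ^ k * (p : ℝ) ^ (-L) := by rw [hx]; gcongr; exact hξ
      _ = (p : ℝ) ^ (k - L) := by rw [← zpow_add₀ (by positivity)]; rfl
      _ ≤ 1 := zpow_le_one_of_nonpos₀ hp.le (by omega)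
  rw [this, setIntegral_const, measureReal_bal p n μ hμ]
  simp

lemma integral_bal_gt (μ : Measure (V p n)) [μ.IsAddHaarMeasure]
    (x : V p n) (L k : ℤ) (hx : ‖x‖ = (p : ℝ) ^ (-L)) (hk : L < k) :
    ∫ ξ in bal p n k, stdChar p (dotP p n ξ x) ∂μ = 0 := by
  have hp := one_lt_p p
  have hx0 : x ≠ 0 := by
    rintro rfl
    rw [norm_zero] at hx
    have : (0 : ℝ) < (p : ℝ) ^ (-L) := by positivity
    linarith
  obtain ⟨i, -, hi, -⟩ := exists_zpow_norm p n hx0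
  set h : V p n := Pi.single i ((p : ℚ_[p]) ^ (-k)) with hh
  have hdot : dotP p n h x = (p : ℚ_[p]) ^ (-k) * x i := by
    simp [dotP, hh, Pi.single_apply]
  have hnh : ‖h‖ = (p : ℝ) ^ k := by rw [hh, Pi.norm_single, norm_p_zpow]
  have hne : stdChar p (dotP p n h x) ≠ 1 := by
    apply stdChar_ne
    rw [hdot, norm_mul, norm_p_zpow, hi, hx, ← zpow_add₀ (by positivity)]
    exact one_lt_zpow₀ hp (by omega)
  have hm := (isClosed_bal p n k).measurableSet
  have key : ∫ ξ in bal p n k, stdChar p (dotP p n ξ x) ∂μ =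
      stdChar p (dotP p n h x) * ∫ ξ in bal p n k, stdChar p (dotP p n ξ x) ∂μ := by
    conv_lhs => rw [← integral_indicator hm, ← integral_add_left_eq_self _ h]
    rw [← integral_const_mul, ← integral_indicator hm]
    congr 1
    ext ξ
    have hiff : h + ξ ∈ bal p n k ↔ ξ ∈ bal p n k := by
      simp only [bal, Set.mem_ofPred_eq]
      constructor
      · intro h1
        have e : ξ = -h + (h + ξ) := by simp
        rw [e]
        exact (IsUltrametricDist.norm_add_le_max _ _).trans (max_le (by rw [norm_neg, hnh]) h1)
      · intro h1
        exact (IsUltrametricDist.norm_add_le_max _ _).trans (max_le hnh.le h1)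
    by_cases hξ : ξ ∈ bal p n k
    · rw [Set.indicator_of_mem (hiff.2 hξ), Set.indicator_of_mem hξ, dotP_add, stdChar_add]
    · rw [Set.indicator_of_notMem (fun h => hξ (hiff.1 h)), Set.indicator_of_notMem hξ]
  have : (1 - stdChar p (dotP p n h x)) * ∫ ξ in bal p n k, stdChar p (dotP p n ξ x) ∂μ = 0 := by
    linear_combination key
  rcases mul_eq_zero.1 this with h1 | h1
  · exact absurd (sub_eq_zero.1 h1).symm hne
  · exact h1

lemma integrableOn_char (μ : Measure (V p n)) [μ.IsAddHaarMeasure] (x : V p n) (k : ℤ) :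
    IntegrableOn (fun ξ => stdChar p (dotP p n ξ x)) (bal p n k) μ := by
  rw [bal_eq]
  exact (continuous_char p n x).continuousOn.integrableOn_compact (isCompact_closedBall _ _)

lemma lt_zpow_iff (ξ : V p n) (k : ℤ) : ‖ξ‖ ≤ (p : ℝ) ^ (k - 1) ↔ ‖ξ‖ < (p : ℝ) ^ k := by
  have hp := one_lt_p p
  by_cases h : ξ = 0
  · subst h
    rw [norm_zero]
    exact ⟨fun _ => by positivity, fun _ => by positivity⟩
  · obtain ⟨-, j, -, hj⟩ := exists_zpow_norm p n h
    rw [hj, zpow_le_zpow_iff_right₀ hp, zpow_lt_zpow_iff_right₀ hp]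
    omega

lemma sph_eq (k : ℤ) : sph p n k = bal p n k \ bal p n (k - 1) := by
  ext ξ
  simp only [sph, bal, Set.mem_ofPred_eq, Set.mem_sdiff, lt_zpow_iff, not_lt]
  exact le_antisymm_iff

/-- The integral of a character over a sphere. -/
def sphC (L k : ℤ) : ℂ :=
  (if k ≤ L then (((p : ℝ) ^ ((n : ℤ) * k) : ℝ) : ℂ) else 0) -
    (if k - 1 ≤ L then (((p : ℝ) ^ ((n : ℤ) * (k - 1)) : ℝ) : ℂ) else 0)

lemma integral_sph (μ : Measure (V p n)) [μ.IsAddHaarMeasure] (hμ : μ (Zpn p n) = 1)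
    (x : V p n) (L k : ℤ) (hx : ‖x‖ = (p : ℝ) ^ (-L)) :
    ∫ ξ in sph p n k, stdChar p (dotP p n ξ x) ∂μ = sphC p n L k := by
  have hp := one_lt_p p
  have hb : ∀ k, ∫ ξ in bal p n k, stdChar p (dotP p n ξ x) ∂μ =
      if k ≤ L then (((p : ℝ) ^ ((n : ℤ) * k) : ℝ) : ℂ) else 0 := by
    intro k
    split_ifs with h
    · exact integral_bal_le p n μ hμ x L k hx h
    · exact integral_bal_gt p n μ x L k hx (not_le.1 h)
  rw [sph_eq, setIntegral_sdiff (isClosed_bal p n _).measurableSet (integrableOn_char p n μ x k),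
    hb, hb, sphC]
  intro ξ hξ
  exact le_trans hξ (zpow_le_zpow_right₀ hp.le (by omega))

lemma measure_zero_pt (hn : 0 < n) (μ : Measure (V p n)) [μ.IsAddHaarMeasure] :
    μ {(0 : V p n)} = 0 := by
  have : Nonempty (Fin n) := ⟨⟨0, hn⟩⟩
  have : (nhdsWithin (0 : V p n) {0}ᶜ).NeBot := by
    exact Module.punctured_nhds_neBot ℚ_[p] (V p n) 0
  exact measure_singleton 0

lemma hasSum_radial (hn : 0 < n) (μ : Measure (V p n)) [μ.IsAddHaarMeasure]
    (hμ : μ (Zpn p n) = 1) (f : V p n → ℂ) (hf : Integrable f μ)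
    (hr : ∀ x y : V p n, ‖x‖ = ‖y‖ → f x = f y)
    (x : V p n) (L : ℤ) (hx : ‖x‖ = (p : ℝ) ^ (-L)) :
    HasSum (fun k : ℤ => sphC p n L k * f (repVec p n ((p : ℝ) ^ k)))
      (∫ ξ, stdChar p (dotP p n ξ x) * f ξ ∂μ) := by
  have hp := one_lt_p p
  have hU : (⋃ k : ℤ, sph p n k) = {0}ᶜ := by
    ext ξ
    simp only [Set.mem_iUnion, sph, Set.mem_ofPred_eq, Set.mem_compl_iff, Set.mem_singleton_iff]
    constructor
    · rintro ⟨k, hk⟩ rfl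
      rw [norm_zero] at hk
      have : (0 : ℝ) < (p : ℝ) ^ k := by positivity
      linarith
    · intro h
      obtain ⟨-, k, -, hk⟩ := exists_zpow_norm p n h
      exact ⟨k, hk⟩
  have hint : Integrable (fun ξ => stdChar p (dotP p n ξ x) * f ξ) μ := by
    apply hf.bdd_mul (c := 1) (continuous_char p n x).aestronglyMeasurable
    exact Eventually.of_forall fun ξ => (norm_stdChar p _).le
  have h := hasSum_integral_iUnion (μ := μ) (s := sph p n)
    (f := fun ξ => stdChar p (dotP p n ξ x) * f ξ)
    (fun k => (isClosed_sph p n k).measurableSet) (by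
      intro a b hab
      rw [Function.onFun, Set.disjoint_left]
      intro ξ ha hb
      apply hab
      simp only [sph, Set.mem_ofPred_eq] at ha hb
      exact zpow_right_injective₀ (by positivity) hp.ne' (ha.symm.trans hb)) hint.integrableOn
  have e : ∫ ξ in ⋃ k, sph p n k, stdChar p (dotP p n ξ x) * f ξ ∂μ =
      ∫ ξ, stdChar p (dotP p n ξ x) * f ξ ∂μ := by
    rw [hU, ← setIntegral_univ (μ := μ)]
    apply setIntegral_congr_set
    exact (ae_eq_univ.2 (by rw [compl_compl]; exact measure_zero_pt p n hn μ))
  rw [e] at h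
  have hfun : (fun k : ℤ => sphC p n L k * f (repVec p n ((p : ℝ) ^ k))) =
      fun k => ∫ ξ in sph p n k, stdChar p (dotP p n ξ x) * f ξ ∂μ := by
    funext k
    rw [← integral_sph p n μ hμ x L k hx, ← integral_mul_const]
    apply setIntegral_congr_fun (isClosed_sph p n k).measurableSet
    intro ξ hξ
    simp only
    rw [hr ξ (repVec p n ((p : ℝ) ^ k)) (by rw [norm_repVec p n hn]; exact hξ)]
  rw [hfun]
  exact h

lemma FT_radial (hn : 0 < n) (μ : Measure (V p n)) [μ.IsAddHaarMeasure]
    (hμ : μ (Zpn p n) = 1) (f : V p n → ℂ) (hf : Integrable f μ)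
    (hr : ∀ x y : V p n, ‖x‖ = ‖y‖ → f x = f y) (x y : V p n) (hxy : ‖x‖ = ‖y‖) :
    FT p n μ f x = FT p n μ f y := by
  by_cases hx : x = 0
  · subst hx
    rw [norm_zero] at hxy
    rw [norm_eq_zero.1 hxy.symm]
  · obtain ⟨-, k, -, hk⟩ := exists_zpow_norm p n hx
    have h1 := hasSum_radial p n hn μ hμ f hf hr x (-k) (by rw [neg_neg]; exact hk)
    have h2 := hasSum_radial p n hn μ hμ f hf hr y (-k) (by rw [neg_neg, ← hxy]; exact hk)
    unfold FT
    simp_rw [dotP_comm p n x, dotP_comm p n y]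
    exact h1.unique h2

lemma norm_FT_le (μ : Measure (V p n)) (f : V p n → ℂ) (x : V p n) :
    ‖FT p n μ f x‖ ≤ ∫ y, ‖f y‖ ∂μ := by
  unfold FT
  refine (norm_integral_le_integral_norm _).trans (le_of_eq ?_)
  simp [norm_stdChar]

lemma measurable_radial (f : V p n → ℂ)
    (hr : ∀ x y : V p n, ‖x‖ = ‖y‖ → f x = f y) : Measurable f := by
  intro S _
  have : f ⁻¹' S = (⋃ k ∈ {k : ℤ | ∃ x ∈ sph p n k, f x ∈ S}, sph p n k) ∪
      (if f 0 ∈ S then {0} else ∅) := by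
    ext ξ
    simp only [Set.mem_preimage, Set.mem_union, Set.mem_iUnion, Set.mem_ofPred_eq, exists_prop]
    constructor
    · intro h
      by_cases h0 : ξ = 0
      · right; subst h0; rw [if_pos h]; rfl
      · obtain ⟨-, k, -, hk⟩ := exists_zpow_norm p n h0
        exact Or.inl ⟨k, ⟨ξ, hk, h⟩, hk⟩
    · rintro (⟨k, ⟨y, hy, hyS⟩, hξ⟩ | h)
      · rw [hr ξ y (Eq.trans hξ hy.symm)]; exact hyS
      · split_ifs at h with h0
        · rw [Set.mem_singleton_iff.1 h]; exact h0
        · exact absurd h (Set.notMem_empty _)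
  rw [this]
  apply MeasurableSet.union
  · exact MeasurableSet.biUnion (Set.to_countable _) fun k _ => (isClosed_sph p n k).measurableSet
  · split_ifs <;> measurability

/-- explicit series representation of the solution `u(x,t)` when the initial
condition `u₀` is radial, locally constant and compactly supported with `supp(Fu₀) ⊆ B_M^n`.
Here `‖x‖ = p^{-L}` (so `L = ord_p(x)`), and `K = -M` if `‖x‖ ≤ p^{-M}`, `K = -M+1` if
`‖x‖ = p^{-M+1}`, `K = -L` if `‖x‖ ≥ p^{-M+2}`. -/
theorem statement11 (hn : 0 < n) (μ : Measure (V p n)) [μ.IsAddHaarMeasure]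
    (hμ : μ (Zpn p n) = 1) (J : V p n → ℝ) (hJ : HypA p n μ J)
    (u₀ : V p n → ℂ) (hrad : ∀ x y : V p n, ‖x‖ = ‖y‖ → u₀ x = u₀ y)
    (hlc : IsLocallyConstant u₀) (hcs : HasCompactSupport u₀)
    (M : ℤ) (hsupp : ∀ ξ : V p n, (p : ℝ) ^ M < ‖ξ‖ → FT p n μ u₀ ξ = 0) :
    ∀ t : ℝ, 0 ≤ t → ∀ x : V p n, x ≠ 0 → ∀ L : ℤ, ‖x‖ = (p : ℝ) ^ (-L) →
      (∫ ξ, stdChar p (-(dotP p n ξ x)) * Complex.exp (-(t : ℂ) * (1 - FJ p n μ J ξ)) *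
          FT p n μ u₀ ξ ∂μ) =
        -(if (p : ℝ) ^ (-M) < ‖x‖ then (1 : ℂ) else 0) * ((‖x‖ ^ (-(n : ℤ)) : ℝ) : ℂ) *
            Complex.exp (-(t : ℂ) * (1 - FJ p n μ J (repVec p n ((p : ℝ) * ‖x‖⁻¹)))) *
            FT p n μ u₀ (repVec p n ((p : ℝ) * ‖x‖⁻¹)) +
          ((1 - (p : ℝ) ^ (-(n : ℤ)) : ℝ) : ℂ) *
            ∑' i : ℕ,
              (((p : ℝ) ^ (-((n : ℤ) * ((if M ≤ L then -M else if L = M - 1 then -M + 1 else -L)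
                  + (i : ℤ)))) : ℝ) : ℂ) *
                Complex.exp (-(t : ℂ) * (1 - FJ p n μ J (repVec p n
                  ((p : ℝ) ^ (-((if M ≤ L then -M else if L = M - 1 then -M + 1 else -L)
                    + (i : ℤ))))))) *
                FT p n μ u₀ (repVec p n
                  ((p : ℝ) ^ (-((if M ≤ L then -M else if L = M - 1 then -M + 1 else -L)
                    + (i : ℤ))))) := by
  intro t ht x hx0 L hx
  have hp := one_lt_p p
  have hJi : Integrable (fun x => (J x : ℂ)) μ := hJ.integrable.ofReal
  have hui : Integrable u₀ μ := hlc.continuous.integrable_of_hasCompactSupport hcs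
  have hJr : ∀ a b : V p n, ‖a‖ = ‖b‖ → FJ p n μ J a = FJ p n μ J b :=
    FT_radial p n hn μ hμ _ hJi (fun a b h => by rw [hJ.radial a b h])
  have hur : ∀ a b : V p n, ‖a‖ = ‖b‖ → FT p n μ u₀ a = FT p n μ u₀ b :=
    FT_radial p n hn μ hμ _ hui hrad
  set G : V p n → ℂ := fun ξ => Complex.exp (-(t : ℂ) * (1 - FJ p n μ J ξ)) * FT p n μ u₀ ξ
    with hG
  have hGr : ∀ a b : V p n, ‖a‖ = ‖b‖ → G a = G b := by
    intro a b h
    simp only [hG]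
    rw [hJr a b h, hur a b h]
  have hGz : ∀ k : ℤ, M < k → G (repVec p n ((p : ℝ) ^ k)) = 0 := by
    intro k hk
    simp only [hG]
    rw [hsupp _ (by rw [norm_repVec p n hn]; exact zpow_lt_zpow_right₀ hp hk), mul_zero]
  have hGi : Integrable G μ := by
    have hbal : IntegrableOn G (bal p n M) μ := by
      refine Measure.integrableOn_of_bounded (M := ∫ y, ‖u₀ y‖ ∂μ)
        (measure_bal_lt_top p n μ M).ne (measurable_radial p n G hGr).aestronglyMeasurable ?_
      refine Eventually.of_forall fun ξ => ?_
      simp only [hG]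
      rw [norm_mul]
      have h1 : ‖Complex.exp (-(t : ℂ) * (1 - FJ p n μ J ξ))‖ ≤ 1 := by
        rw [Complex.norm_exp, Real.exp_le_one_iff]
        have h2 : (FJ p n μ J ξ).re ≤ 1 := by
          refine (Complex.re_le_norm _).trans ((norm_FT_le p n μ _ ξ).trans (le_of_eq ?_))
          rw [← hJ.int_one]
          congr 1
          ext y
          rw [Complex.norm_real, Real.norm_of_nonneg (hJ.nonneg y)]
        have h3 : (-(t : ℂ) * (1 - FJ p n μ J ξ)).re = -(t * (1 - (FJ p n μ J ξ).re)) := by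
          simp
        rw [h3]
        have := mul_nonneg ht (sub_nonneg.2 h2)
        linarith
      calc _ ≤ 1 * ‖FT p n μ u₀ ξ‖ := by gcongr
        _ ≤ _ := by rw [one_mul]; exact norm_FT_le p n μ u₀ ξ
    rw [← integrableOn_iff_integrable_of_support_subset (s := bal p n M)]
    · exact hbal
    · intro ξ hξ
      by_contra h
      apply hξ
      simp only [hG]
      rw [hsupp ξ (not_le.1 h), mul_zero]
  have hsum := hasSum_radial p n hn μ hμ G hGi hGr (-x) L (by rw [norm_neg]; exact hx)
  have hpx : (p : ℝ) * ‖x‖⁻¹ = (p : ℝ) ^ (L + 1) := by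
    rw [hx, zpow_neg, inv_inv, zpow_add_one₀ (by positivity), mul_comm]
  have hxn : ‖x‖ ^ (-(n : ℤ)) = (p : ℝ) ^ ((n : ℤ) * L) := by
    rw [hx, ← zpow_mul]; congr 1; ring
  have hind : (if (p : ℝ) ^ (-M) < ‖x‖ then (1 : ℂ) else 0) = if L < M then 1 else 0 := by
    have hiff : (p : ℝ) ^ (-M) < ‖x‖ ↔ L < M := by
      rw [hx, zpow_lt_zpow_iff_right₀ hp, neg_lt_neg_iff]
    by_cases h : L < M
    · rw [if_pos h, if_pos (hiff.2 h)]
    · rw [if_neg h, if_neg (fun h' => h (hiff.1 h'))]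
  have hK : (if M ≤ L then -M else if L = M - 1 then -M + 1 else -L) = - min L M := by
    split_ifs <;> omega
  rw [hpx, hxn, hind, hK]
  set g : ℤ → ℂ := fun k => G (repVec p n ((p : ℝ) ^ k)) with hg
  set d : ℤ → ℂ := fun k => if k ≤ min L M then (((p : ℝ) ^ ((n : ℤ) * k) : ℝ) : ℂ) * g k else 0
    with hd
  have hterm : ∀ k : ℤ, sphC p n L k * g k =
      ((1 - (p : ℝ) ^ (-(n : ℤ)) : ℝ) : ℂ) * d k +
      (if k = L + 1 then -(((p : ℝ) ^ ((n : ℤ) * L) : ℝ) : ℂ) * g (L + 1) else 0) := by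
    intro k
    have hz : M < k → g k = 0 := hGz k
    simp only [hd, sphC]
    by_cases h1 : k = L + 1
    · subst h1
      rw [if_neg (by omega), if_pos (by omega), if_neg (by omega), if_pos rfl,
        add_sub_cancel_right]
      ring
    · rw [if_neg h1]
      by_cases h2 : k ≤ L
      · by_cases h3 : M < k
        · rw [hz h3]; simp
        · rw [if_pos h2, if_pos (by omega), if_pos (by omega)]
          have : (p : ℝ) ^ ((n : ℤ) * (k - 1)) =
              (p : ℝ) ^ (-(n : ℤ)) * (p : ℝ) ^ ((n : ℤ) * k) := by
            rw [← zpow_add₀ (by positivity)]; congr 1; ring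
          rw [this]
          push_cast
          ring
      · rw [if_neg h2, if_neg (by omega), if_neg (by omega)]
        simp
  have hsum2 : HasSum (fun k => ((1 - (p : ℝ) ^ (-(n : ℤ)) : ℝ) : ℂ) * d k)
      ((∫ ξ, stdChar p (dotP p n ξ (-x)) * G ξ ∂μ) -
        -(((p : ℝ) ^ ((n : ℤ) * L) : ℝ) : ℂ) * g (L + 1)) := by
    have hs := hsum.sub (hasSum_ite_eq (L + 1) (-(((p : ℝ) ^ ((n : ℤ) * L) : ℝ) : ℂ) * g (L + 1)))
    refine hs.congr_fun ?_
    intro k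
    have := hterm k
    simp only [hg] at this ⊢
    rw [this]
    ring
  have hts := hsum2.tsum_eq
  rw [tsum_mul_left] at hts
  have hinj : Function.Injective (fun i : ℕ => -(-min L M + (i : ℤ))) := by
    intro a b h
    simp only at h
    omega
  have hre := hinj.tsum_eq (f := d) (by
    intro k hk
    have hk' : k ≤ min L M := by
      by_contra h
      apply hk
      simp only [hd]
      rw [if_neg h]
    refine ⟨(min L M - k).toNat, ?_⟩
    simp only
    omega)
  have hL : (∫ ξ, stdChar p (-(dotP p n ξ x)) * Complex.exp (-(t : ℂ) * (1 - FJ p n μ J ξ)) *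
          FT p n μ u₀ ξ ∂μ) = ∫ ξ, stdChar p (dotP p n ξ (-x)) * G ξ ∂μ := by
    congr 1
    ext ξ
    rw [dotP_neg, mul_assoc]
  have hR : (∑' i : ℕ, (((p : ℝ) ^ (-((n : ℤ) * (-min L M + (i : ℤ)))) : ℝ) : ℂ) *
                Complex.exp (-(t : ℂ) * (1 - FJ p n μ J (repVec p n
                  ((p : ℝ) ^ (-(-min L M + (i : ℤ))))))) *
                FT p n μ u₀ (repVec p n ((p : ℝ) ^ (-(-min L M + (i : ℤ)))))) = ∑' k, d k := by
    rw [← hre]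
    congr 1
    ext i
    simp only [hd]
    rw [if_pos (by omega), mul_assoc, ← mul_neg]
  rw [hL, hR, hts]
  have hlast : -(if L < M then (1 : ℂ) else 0) * (((p : ℝ) ^ ((n : ℤ) * L) : ℝ) : ℂ) *
      Complex.exp (-(t : ℂ) * (1 - FJ p n μ J (repVec p n ((p : ℝ) ^ (L + 1))))) *
      FT p n μ u₀ (repVec p n ((p : ℝ) ^ (L + 1))) =
      -(((p : ℝ) ^ ((n : ℤ) * L) : ℝ) : ℂ) * g (L + 1) := by
    split_ifs with h
    · simp only [hg, hG]; ring
    · rw [show g (L + 1) = 0 from hGz _ (by omega)]; simp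
  rw [hlast]
  ring

end PadicPaper
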